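/- Let R be a discrete valuation ring, let a ≥ 0 be an integer, let A be an a × (a+1) matrix over R, and let φ : R^{a+1} → R^a be the associated linear map. Assume the cokernel R^a/im(φ) is a torsion R-module (equivalently, has finite length). Define v ∈ R^{a+1} by v_j = (−1)^j · det(A_ĵ), where A_ĵ is A with column j deleted. Then: v ∈ ker(φ); ker(φ) is a free R-module of rank 1; and the length of the R-module ker(φ)/R·v equals the length of R^a/im(φ). -/

import Mathlib

namespace SignedMinors
open Module

variable {R : Type*} [CommRing R]

/-- Laplace expansion of the matrix `A` bordered by a first row `w`. -/
lemma det_cons (a : ℕ) (A : Matrix (Fin a) (Fin (a + 1)) R) (w : Fin (a + 1) → R) :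
    (Matrix.of (Fin.cons w A : Fin (a + 1) → Fin (a + 1) → R)).det =
      ∑ j, w j * ((-1 : R) ^ (j : ℕ) * (A.submatrix id j.succAbove).det) := by
  rw [Matrix.det_succ_row_zero]
  refine Finset.sum_congr rfl fun j _ => ?_
  have : (Matrix.of (Fin.cons w A : Fin (a + 1) → Fin (a + 1) → R)).submatrix Fin.succ j.succAbove
      = A.submatrix id j.succAbove := by
    ext i l; rfl
  rw [this]
  change (-1 : R) ^ (j : ℕ) * w j * _ = _
  ring

lemma mem_ker (a : ℕ) (A : Matrix (Fin a) (Fin (a + 1)) R) :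
    (fun j : Fin (a + 1) => (-1 : R) ^ (j : ℕ) * (A.submatrix id j.succAbove).det) ∈
      LinearMap.ker A.mulVecLin := by
  rw [LinearMap.mem_ker]
  ext i
  simp only [Matrix.mulVecLin_apply, Matrix.mulVec, dotProduct, Pi.zero_apply]
  rw [← det_cons a A (A i)]
  refine Matrix.det_zero_of_row_eq (i := 0) (j := i.succ) (Fin.succ_ne_zero i).symm ?_
  rfl

lemma ord_prod [IsDomain R] {ι : Type*} (s : Finset ι) (f : ι → R) (hf : ∀ i, f i ≠ 0) :
    Ring.ord R (∏ i ∈ s, f i) = ∑ i ∈ s, Ring.ord R (f i) := by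
  classical
  induction s using Finset.induction_on with
  | empty => simp
  | insert i s hi ih =>
    rw [Finset.prod_insert hi, Finset.sum_insert hi,
      Ring.ord_mul' R (mem_nonZeroDivisors_of_ne_zero (hf i)), ih]

lemma ord_associated {x y : R} (h : Associated x y) : Ring.ord R x = Ring.ord R y := by
  unfold Ring.ord
  obtain ⟨u, rfl⟩ := h
  rw [Ideal.span_singleton_mul_right_unit u.isUnit]

/-- The length of the quotient by the image of a diagonal matrix in Smith form. -/
lemma length_quot [IsDomain R] [IsPrincipalIdealRing R] (a : ℕ) (N : Submodule R (Fin a → R))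
    (h : finrank R N = finrank R (Fin a → R)) :
    ∃ n : Basis (Fin a) R N,
      Module.length R ((Fin a → R) ⧸ N) =
        Ring.ord R (Matrix.of fun i j => (n j : Fin a → R) i).det := by
  let b := Pi.basisFun R (Fin a)
  let n := Submodule.smithNormalFormBotBasis b h
  let d := Submodule.smithNormalFormCoeffs b h
  let t := Submodule.smithNormalFormTopBasis b h
  refine ⟨n, ?_⟩
  have h1 : (Matrix.of fun i j => (n j : Fin a → R) i) = b.toMatrix t * Matrix.diagonal d := by
    ext i j
    simp [n, d, t, b, Basis.toMatrix_apply, mul_comm]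
  rw [h1, Matrix.det_mul, Matrix.det_diagonal,
    (Submodule.quotientEquivPiSpan N b h).length_eq, Module.length_pi_of_fintype]
  have h2 : Associated ((b.toMatrix t).det * ∏ i, d i) (∏ i, d i) := by
    have := b.isUnit_det t
    rw [Basis.det_apply] at this
    exact (associated_isUnit_mul_left_iff this).mpr (Associated.refl _)
  rw [ord_associated h2, ord_prod _ _ (fun i => Submodule.smithNormalFormCoeffs_ne_zero b h i)]
  rfl

lemma finrank_range [IsDomain R] (a : ℕ) (A : Matrix (Fin a) (Fin (a + 1)) R)
    (htor : Module.IsTorsion R ((Fin a → R) ⧸ LinearMap.range A.mulVecLin)) :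
    finrank R (LinearMap.range A.mulVecLin) = finrank R (Fin a → R) := by
  have h0 : Module.rank R ((Fin a → R) ⧸ LinearMap.range A.mulVecLin) = 0 :=
    Module.rank_eq_zero_iff_isTorsion.mpr htor
  have h := rank_quotient_add_rank_of_isDomain (LinearMap.range A.mulVecLin)
  rw [h0, zero_add] at h
  exact congrArg Cardinal.toNat h

lemma finrank_ker [IsDomain R] [IsPrincipalIdealRing R]
    (a : ℕ) (A : Matrix (Fin a) (Fin (a + 1)) R)
    (htor : Module.IsTorsion R ((Fin a → R) ⧸ LinearMap.range A.mulVecLin)) :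
    finrank R (LinearMap.ker A.mulVecLin) = 1 := by
  have h := Submodule.finrank_quotient_add_finrank (LinearMap.ker A.mulVecLin)
  rw [A.mulVecLin.quotKerEquivRange.finrank_eq, finrank_range a A htor] at h
  simp only [finrank_fintype_fun_eq_card, Fintype.card_fin] at h
  omega

lemma associated_det (a : ℕ) (A : Matrix (Fin a) (Fin (a + 1)) R)
    (n : Basis (Fin a) R (LinearMap.range A.mulVecLin))
    (k : Basis Unit R (LinearMap.ker A.mulVecLin))
    (hv : (fun j : Fin (a + 1) => (-1 : R) ^ (j : ℕ) * (A.submatrix id j.succAbove).det) ∈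
      LinearMap.ker A.mulVecLin) :
    Associated (k.repr ⟨_, hv⟩ ()) (Matrix.of fun i j => (n j : Fin a → R) i).det := by
  set c := k.repr ⟨_, hv⟩ () with hc
  have hvc : ∀ j : Fin (a + 1), (-1 : R) ^ (j : ℕ) * (A.submatrix id j.succAbove).det
      = c * (k () : Fin (a + 1) → R) j := by
    have h1 := k.sum_repr ⟨_, hv⟩
    intro j
    have h2 := congrFun (congrArg Subtype.val h1) j
    simp at h2
    rw [← h2]
  have hm : ∀ j, ∃ m : Fin (a + 1) → R, A.mulVecLin m = (n j : Fin a → R) := fun j => (n j).2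
  choose m hm using hm
  let P : Matrix (Fin (a + 1)) (Fin (a + 1)) R :=
    (Matrix.of (Fin.cons (k () : Fin (a + 1) → R) m : Fin (a + 1) → Fin (a + 1) → R)).transpose
  have hP : IsUnit P := by
    rw [← Matrix.mulVec_surjective_iff_isUnit]
    intro z
    let y : LinearMap.range A.mulVecLin := ⟨A.mulVecLin z, z, rfl⟩
    have hz : z - ∑ j, n.repr y j • m j ∈ LinearMap.ker A.mulVecLin := by
      rw [LinearMap.mem_ker, map_sub, map_sum, sub_eq_zero]
      simp only [map_smul, hm]
      have := congrArg Subtype.val (n.sum_repr y)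
      simp only [Submodule.coe_sum, Submodule.coe_smul] at this
      exact this.symm
    have hk := congrArg Subtype.val (k.sum_repr ⟨_, hz⟩)
    simp only [Submodule.coe_sum, Submodule.coe_smul, Finset.univ_unique, Finset.sum_singleton] at hk
    refine ⟨Fin.cons (k.repr ⟨_, hz⟩ ()) (n.repr y), ?_⟩
    rw [eq_sub_iff_add_eq] at hk
    refine Eq.trans ?_ hk
    ext i
    simp [P, Matrix.mulVec, dotProduct, Fin.sum_univ_succ, Finset.sum_apply, mul_comm]
  have hPd : IsUnit P.det := (Matrix.isUnit_iff_isUnit_det P).mp hP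
  let w : Fin (a + 1) → R := P⁻¹ 0
  have hw : ∀ j, ∑ l, w l * P l j = (1 : Matrix (Fin (a + 1)) (Fin (a + 1)) R) 0 j := by
    intro j
    rw [← Matrix.nonsing_inv_mul P hPd, Matrix.mul_apply]
  let W := Matrix.of (Fin.cons w A : Fin (a + 1) → Fin (a + 1) → R)
  have hW : W.det = c := by
    rw [det_cons]
    simp only [hvc]
    have := hw 0
    simp only [P, Matrix.transpose_apply, Matrix.of_apply, Fin.cons_zero, Matrix.one_apply_eq] at this
    calc _ = c * ∑ x, w x * (k () : Fin (a + 1) → R) x := by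
          rw [Finset.mul_sum]
          exact Finset.sum_congr rfl fun _ _ => by ring
      _ = c := by rw [this, mul_one]
  have hk0 : ∀ i, ∑ l, A i l * (k () : Fin (a + 1) → R) l = 0 := fun i =>
    congrFun (LinearMap.mem_ker.mp (k ()).2) i
  have hWP : (W * P).det = (Matrix.of fun i j => (n j : Fin a → R) i).det := by
    rw [Matrix.det_succ_row_zero, Fin.sum_univ_succ]
    have h0 : ∀ j, (W * P) 0 j = (1 : Matrix (Fin (a + 1)) (Fin (a + 1)) R) 0 j := by
      intro j
      rw [← hw j, Matrix.mul_apply]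
      rfl
    have hs : (W * P).submatrix Fin.succ (Fin.succAbove 0)
        = Matrix.of fun i j => (n j : Fin a → R) i := by
      ext i j
      rw [Matrix.of_apply, ← hm j]
      rfl
    rw [hs]
    simp [h0, Matrix.one_apply, (Fin.succ_ne_zero _).symm]
  rw [← hWP, Matrix.det_mul, hW]
  exact (associated_mul_isUnit_right_iff hPd).mpr (Associated.refl _)

lemma length_quot_span (M : Type*) [AddCommGroup M] [Module R M] (k : Basis Unit R M) (x : M) :
    Module.length R (M ⧸ Submodule.span R {x}) = Ring.ord R (k.repr x ()) := by
  let e : M ≃ₗ[R] R := k.equivFun.trans (LinearEquiv.funUnique Unit R R)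
  have : Submodule.map (e : M →ₗ[R] R) (Submodule.span R {x}) = Ideal.span {k.repr x ()} := by
    rw [Submodule.map_span, Set.image_singleton]
    rfl
  exact (Submodule.Quotient.equiv _ _ e this).length_eq

end SignedMinors


/-- The length of an `R`-module `M`, defined as the Krull dimension of its lattice of
submodules (the supremum of the lengths of chains of submodules). -/
noncomputable def moduleLength (R M : Type*) [Semiring R] [AddCommGroup M] [Module R M] :
    WithBot ℕ∞ :=
  Order.krullDim (Submodule R M)

/-- Let `R` be a discrete valuation ring, `A` an `a × (a+1)` matrix over `R` with associated
linear map `φ : R^(a+1) → R^a`, and assume `coker φ` is torsion.  Let `v` be the vector of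
signed maximal minors, `v_j = (−1)^j det(A_ĵ)`.  Then `v ∈ ker φ`, `ker φ` is free of rank
one, and the length of `ker φ / R·v` equals the length of `coker φ`. -/
theorem signed_minors_generate_kernel_up_to_length_of_coker
    {R : Type*} [CommRing R] [IsDomain R] [IsDiscreteValuationRing R]
    (a : ℕ) (A : Matrix (Fin a) (Fin (a + 1)) R)
    (htor : Module.IsTorsion R ((Fin a → R) ⧸ LinearMap.range A.mulVecLin)) :
    let v : Fin (a + 1) → R :=
      fun j => (-1 : R) ^ (j : ℕ) * (A.submatrix id j.succAbove).det
    v ∈ LinearMap.ker A.mulVecLin ∧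
    (Module.Free R ↥(LinearMap.ker A.mulVecLin) ∧
      Module.rank R ↥(LinearMap.ker A.mulVecLin) = 1) ∧
    (∀ hv : v ∈ LinearMap.ker A.mulVecLin,
      moduleLength R
          (↥(LinearMap.ker A.mulVecLin) ⧸
            Submodule.span R {(⟨v, hv⟩ : ↥(LinearMap.ker A.mulVecLin))})
        = moduleLength R ((Fin a → R) ⧸ LinearMap.range A.mulVecLin)) := by
  intro v
  have hr := SignedMinors.finrank_ker a A htor
  refine ⟨SignedMinors.mem_ker a A, ⟨inferInstance, ?_⟩, fun hv => ?_⟩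
  · rw [← Module.finrank_eq_rank, hr, Nat.cast_one]
  · obtain ⟨n, hn⟩ := SignedMinors.length_quot a _ (SignedMinors.finrank_range a A htor)
    let k := Module.basisUnique Unit hr
    unfold moduleLength
    rw [← Module.coe_length, ← Module.coe_length, hn, SignedMinors.length_quot_span _ k,
      SignedMinors.ord_associated (SignedMinors.associated_det a A n k hv)]
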